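/- arXiv:1707.04874 — 2 statements merged into one kernel-verified Lean document; each statement's English description precedes it below -/
import Mathlib

section
/- Let G be a finite simple graph with no odd cycle of length at most 2k-1 (k ≥ 2). If u and v are vertices such that u is even-connected to v with respect to a single edge e = {x,y} (i.e., G contains a path u, x, y, v of length 3), and additionally another pair w, z of vertices is even-connected with respect to e via the path w, y, x, z, then considering the graph G' obtained from G by adding all such even-connected pairs as new edges, G' has no odd cycle of length at most 2k-3. -/
namespace SimpleGraph

variable {V : Type*} {G : SimpleGraph V}

/-- A walk either shortens to a path whose length has the same parity, or there is an odd cycle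
that is no longer than the walk. -/
theorem Walk.exists_isPath_or_odd_isCycle {u v : V} (p : G.Walk u v) :
    (∃ q : G.Walk u v, q.IsPath ∧ q.length ≤ p.length ∧ q.length % 2 = p.length % 2) ∨
      ∃ (w : V) (c : G.Walk w w), c.IsCycle ∧ Odd c.length ∧ c.length ≤ p.length := by
  classical
  induction p with
  | nil => exact .inl ⟨.nil, .nil, le_rfl, rfl⟩
  | @cons u a v h p ih =>
    obtain ⟨q, hq, hle, hpar⟩ | ⟨w, c, hc, hodd, hle⟩ := ih
    · by_cases hu : u ∈ q.support
      · have hlen : (q.takeUntil u hu).length + (q.dropUntil u hu).length = q.length := by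
          rw [← Walk.length_append, Walk.take_spec]
        rcases Nat.even_or_odd (q.takeUntil u hu).length with hev | hodd
        · have hne : (q.takeUntil u hu).length ≠ 0 :=
            fun h0 => h.ne' (Walk.eq_of_length_eq_zero h0)
          refine .inr ⟨u, .cons h (q.takeUntil u hu), ?_, ?_, ?_⟩
          · refine Walk.isCycle_iff_isPath_tail_and_le_length.mpr ⟨?_, ?_⟩
            · simpa using hq.takeUntil hu
            · grind [Walk.length_cons]
          · grind [Walk.length_cons]
          · grind [Walk.length_cons]
        · exact .inl ⟨q.dropUntil u hu, hq.dropUntil hu, by grind [Walk.length_cons],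
            by grind [Walk.length_cons]⟩
      · exact .inl ⟨.cons h q, hq.cons hu, by grind [Walk.length_cons],
          by grind [Walk.length_cons]⟩
    · exact .inr ⟨w, c, hc, hodd, by grind [Walk.length_cons]⟩

/-- An odd closed walk is at least as long as some odd cycle. -/
theorem Walk.exists_odd_isCycle_length_le {u : V} (p : G.Walk u u) (hp : Odd p.length) :
    ∃ (w : V) (c : G.Walk w w), c.IsCycle ∧ Odd c.length ∧ c.length ≤ p.length := by
  obtain ⟨q, hq, -, hpar⟩ | h := p.exists_isPath_or_odd_isCycle
  · rw [(Walk.isPath_iff_nil.mp hq).length_eq_zero] at hpar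
    grind
  · exact h

/-- Let `xy` be an edge of `G`, and suppose each edge of `G'` is an edge of `G` or joins the ends
of a walk `a, p, q, b` of `G` with `{p, q} = {x, y}`. If `G` has no short odd closed walk, then a
short walk of `G'` is replaced by a walk of `G` of the same parity which is no longer, or which
passes through `xy` and is longer by at most two. -/
theorem Walk.exists_walk_of_adj_or_even_connected {G' : SimpleGraph V} {m : ℕ} {x y : V}
    (hxy : G.Adj x y)
    (hgirth : ∀ (u : V) (c : G.Walk u u), Odd c.length → m + 4 ≤ c.length)
    (hG' : ∀ a b, G'.Adj a b → G.Adj a b ∨ ∃ p q, s(p, q) = s(x, y) ∧ G.Adj a p ∧ G.Adj q b)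
    {a b : V} (c : G'.Walk a b) (hc : c.length ≤ m) :
    (∃ w : G.Walk a b, w.length ≤ c.length ∧ w.length % 2 = c.length % 2) ∨
      ∃ p q, s(p, q) = s(x, y) ∧ ∃ (w : G.Walk a p) (w' : G.Walk q b),
        w.length + w'.length ≤ c.length + 1 ∧
          (w.length + w'.length + 1) % 2 = c.length % 2 := by
  induction c with
  | nil => exact .inl ⟨.nil, le_rfl, rfl⟩
  | @cons a' a b h c ih =>
    rw [Walk.length_cons] at hc ⊢
    obtain ⟨w, hle, hpar⟩ | ⟨p, q, hpq, w, w', hle, hpar⟩ := ih (by omega)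
    · obtain h | ⟨p, q, hpq, hp, hq⟩ := hG' _ _ h
      · exact .inl ⟨.cons h w, by grind [Walk.length_cons], by grind [Walk.length_cons]⟩
      · exact .inr ⟨p, q, hpq, .cons hp .nil, .cons hq w,
          by grind [Walk.length_cons, Walk.length_nil],
          by grind [Walk.length_cons, Walk.length_nil]⟩
    · obtain h | ⟨p', q', hpq', hp, hq⟩ := hG' _ _ h
      · exact .inr ⟨p, q, hpq, .cons h w, w', by grind [Walk.length_cons],
          by grind [Walk.length_cons]⟩
      · obtain ⟨rfl, rfl⟩ | ⟨rfl, rfl⟩ := Sym2.eq_iff.mp (hpq'.trans hpq.symm)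
        · rcases Nat.even_or_odd w.length with hev | hodd
          · exact .inr ⟨p', q', hpq, .cons hp .nil, w',
              by grind [Walk.length_cons, Walk.length_nil],
              by grind [Walk.length_cons, Walk.length_nil]⟩
          · have hadj : G.Adj p' q' := by
              rwa [← SimpleGraph.mem_edgeSet, hpq, SimpleGraph.mem_edgeSet]
            have := hgirth _ (.cons hadj (.cons hq w)) (by grind [Walk.length_cons])
            grind [Walk.length_cons]
        · rcases Nat.even_or_odd w.length with hev | hodd
          · have := hgirth _ (.cons hq w) (by grind [Walk.length_cons])
            grind [Walk.length_cons]
          · refine .inl ⟨.cons hp w', ?_, ?_⟩ <;> grind [Walk.length_cons]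

end SimpleGraph

/-- Let `G` have no odd cycle of length at most `2k-1` (`k ≥ 2`), and let `e = {x,y}` be an
edge of `G`.  Let `G'` be obtained from `G` by adding, as new edges, all pairs `{u,v}` of
distinct vertices that are even-connected with respect to `e`, i.e. such that `G` contains
a path `u,x,y,v` (or `u,y,x,v`).  Then `G'` has no odd cycle of length at most `2k-3`. -/
theorem oddGirth_colon_single_edge {V : Type*} [Fintype V] (G : SimpleGraph V) (k : ℕ)
    (hk : 2 ≤ k)
    (hgirth : ∀ (u : V) (c : G.Walk u u), c.IsCycle → Odd c.length → 2 * k + 1 ≤ c.length)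
    (x y : V) (hxy : G.Adj x y)
    (G' : SimpleGraph V)
    (hG' : G' = G ⊔ SimpleGraph.fromRel (fun u v => G.Adj u x ∧ G.Adj y v)) :
    ∀ (u : V) (c : G'.Walk u u), c.IsCycle → Odd c.length → 2 * k - 1 ≤ c.length := by
  intro u c _ hodd
  have hwalk : ∀ (u : V) (c : G.Walk u u), Odd c.length → 2 * k - 3 + 4 ≤ c.length := by
    intro u c hc
    obtain ⟨w, d, hd, hd', hle⟩ := c.exists_odd_isCycle_length_le hc
    have := hgirth w d hd hd'
    omega
  have hadj : ∀ a b, G'.Adj a b →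
      G.Adj a b ∨ ∃ p q, s(p, q) = s(x, y) ∧ G.Adj a p ∧ G.Adj q b := by
    intro a b h
    rw [hG', SimpleGraph.sup_adj, SimpleGraph.fromRel_adj] at h
    obtain h | ⟨-, ⟨h₁, h₂⟩ | ⟨h₁, h₂⟩⟩ := h
    · exact .inl h
    · exact .inr ⟨x, y, rfl, h₁, h₂⟩
    · exact .inr ⟨y, x, Sym2.eq_swap, h₂.symm, h₁.symm⟩
  by_contra! hlt
  obtain ⟨w, hle, hpar⟩ | ⟨p, q, hpq, w, w', hle, hpar⟩ :=
    c.exists_walk_of_adj_or_even_connected hxy hwalk hadj (by grind)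
  · have := hwalk _ w (by grind)
    omega
  · have hqp : G.Adj p q := by
      rwa [← SimpleGraph.mem_edgeSet, hpq, SimpleGraph.mem_edgeSet]
    have := hwalk _ (w.append (.cons hqp w'))
      (by grind [SimpleGraph.Walk.length_append, SimpleGraph.Walk.length_cons])
    grind [SimpleGraph.Walk.length_append, SimpleGraph.Walk.length_cons]
end

section
/- Let G be a simple graph, e = {x,y} an edge of G, and define G' by adding to G all edges {u,v} with u ≠ v such that G contains a path u,x,y,v or u,y,x,v. If G has no odd closed walk of length at most 2k-1 (k ≥ 2), then for any cycle C in G' of odd length 2ℓ-1 with ℓ ≤ k-1, replacing each edge of C not in G by the corresponding length-3 path through x,y yields an odd closed walk in G of length at most 2ℓ+1, hence G' contains no odd cycle of length 2ℓ-1. -/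
namespace SimpleGraph

variable {V : Type*} {G : SimpleGraph V}

/-- Every walk can be shortened to a path with the same parity of length, unless some odd cycle is
at most as long as the walk. -/
theorem Walk.exists_isPath_even_add_or_exists_odd_isCycle {u v : V} (p : G.Walk u v) :
    (∃ q : G.Walk u v, q.IsPath ∧ q.length ≤ p.length ∧ Even (q.length + p.length)) ∨
      ∃ (w : V) (c : G.Walk w w), c.IsCycle ∧ Odd c.length ∧ c.length ≤ p.length := by
  classical
  induction p with
  | nil => exact .inl ⟨.nil, by simp⟩
  | @cons u w v h p ih =>
    obtain ⟨q, hq, hle, hpar⟩ | ⟨z, c, hc, hodd, hle⟩ := ih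
    · by_cases hu : u ∈ q.support
      · have hlen : (q.takeUntil u hu).length + (q.dropUntil u hu).length = q.length := by
          rw [← Walk.length_append, Walk.take_spec]
        by_cases hpar' : Even (q.takeUntil u hu).length
        · refine .inr ⟨u, .cons h (q.takeUntil u hu), ?_, ?_, ?_⟩
          · refine (Walk.cons_isCycle_iff _ _).2 ⟨hq.takeUntil hu, fun hmem => ?_⟩
            rw [(hq.takeUntil hu).length_eq_one_of_mem_edges (Sym2.eq_swap ▸ hmem)] at hpar'
            exact absurd hpar' (by decide)
          · simpa using hpar'.add_one
          · simp only [Walk.length_cons]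
            omega
        · refine .inl ⟨q.dropUntil u hu, hq.dropUntil hu, ?_, ?_⟩
          · simp only [Walk.length_cons]
            omega
          · simp only [Walk.length_cons]
            grind
      · refine .inl ⟨.cons h q, hq.cons hu, ?_, ?_⟩
        · simpa using hle
        · simp only [Walk.length_cons]
          grind
    · exact .inr ⟨z, c, hc, hodd, hle.trans (by simp)⟩

/-- If the ends of the edge `s(f false, f true)` are joined by a walk whose parity disagrees with
the walk along that edge, there is an odd closed walk at most one longer. -/
theorem Walk.exists_odd_closed_of_ends {f : Bool → V} (hf : G.Adj (f false) (f true)) {i j : Bool}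
    (p : G.Walk (f i) (f j)) (hp : Odd (p.length + (i ^^ j).toNat)) :
    ∃ (w : V) (c : G.Walk w w), Odd c.length ∧ c.length ≤ p.length + 1 := by
  cases i <;> cases j
  · exact ⟨_, p, by simpa using hp, by simp⟩
  · exact ⟨_, .cons hf.symm p, by simpa using hp, by simp⟩
  · exact ⟨_, .cons hf p, by simpa using hp, by simp⟩
  · exact ⟨_, p, by simpa using hp, by simp⟩

/-- Let `G'` be obtained from `G` by adding edges between the ends of walks of length three whose
middle edge is `s(f false, f true)`. A walk of `G'` lifts to a walk of `G` of the same parity, or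
to two walks of `G` reaching the edge from both sides, unless there is a short odd closed walk. -/
theorem Walk.lift_of_adj_imp {G' : SimpleGraph V} {f : Bool → V}
    (hf : G.Adj (f false) (f true))
    (hG' : ∀ u v, G'.Adj u v → G.Adj u v ∨ ∃ i, G.Adj u (f i) ∧ G.Adj (f !i) v)
    {u v : V} (p : G'.Walk u v) :
    (∃ q : G.Walk u v, q.length ≤ p.length ∧ Even (q.length + p.length)) ∨
    (∃ (i j : Bool) (q : G.Walk u (f i)) (r : G.Walk (f j) v),
      q.length + r.length ≤ p.length + 1 ∧
        Even (q.length + r.length + (i ^^ j).toNat + p.length)) ∨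
    ∃ (w : V) (c : G.Walk w w), Odd c.length ∧ c.length ≤ p.length + 2 := by
  induction p with
  | nil => exact .inl ⟨.nil, by simp⟩
  | @cons u w v h p ih =>
    simp only [Walk.length_cons]
    obtain ⟨q, hle, hpar⟩ | ⟨i, j, q, r, hle, hpar⟩ | ⟨z, c, hodd, hle⟩ := ih
    · obtain h | ⟨a, hu, hw⟩ := hG' _ _ h
      · refine .inl ⟨.cons h q, ?_, ?_⟩ <;> simp only [Walk.length_cons] <;> grind
      · refine .inr (.inl ⟨a, !a, hu.toWalk, .cons hw q, ?_, ?_⟩)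
        · simp only [Walk.length_cons, Walk.length_nil]
          omega
        · cases a <;> simp <;> grind
    · obtain h | ⟨a, hu, hw⟩ := hG' _ _ h
      · refine .inr (.inl ⟨i, j, .cons h q, r, ?_, ?_⟩) <;>
          simp only [Walk.length_cons] <;> grind
      · by_cases hodd : Odd ((Walk.cons hw q).length + ((!a) ^^ i).toNat)
        · obtain ⟨z, c, hc, hcle⟩ := Walk.exists_odd_closed_of_ends hf _ hodd
          refine .inr (.inr ⟨z, c, hc, ?_⟩)
          simp only [Walk.length_cons] at hcle
          omega
        · refine .inr (.inl ⟨a, j, hu.toWalk, r, ?_, ?_⟩)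
          · simp only [Walk.length_cons, Walk.length_nil]
            omega
          · simp only [Walk.length_cons, Walk.length_nil] at hodd ⊢
            cases a <;> cases i <;> cases j <;> simp at hodd hpar ⊢ <;> grind
    · exact .inr (.inr ⟨z, c, hodd, by omega⟩)

/-- If `G'` is obtained from `G` by adding edges between the ends of walks of length three with
middle edge `s(f false, f true)`, then an odd closed walk of `G'` yields an odd closed walk of `G`
that is longer by at most two. -/
theorem Walk.exists_odd_closed_of_adj_imp {G' : SimpleGraph V} {f : Bool → V}
    (hf : G.Adj (f false) (f true))
    (hG' : ∀ u v, G'.Adj u v → G.Adj u v ∨ ∃ i, G.Adj u (f i) ∧ G.Adj (f !i) v)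
    {u : V} (p : G'.Walk u u) (hp : Odd p.length) :
    ∃ (w : V) (c : G.Walk w w), Odd c.length ∧ c.length ≤ p.length + 2 := by
  obtain ⟨q, hle, hpar⟩ | ⟨i, j, q, r, hle, hpar⟩ | h := Walk.lift_of_adj_imp hf hG' p
  · exact ⟨u, q, by grind, by omega⟩
  · obtain ⟨w, c, hc, hcle⟩ := Walk.exists_odd_closed_of_ends hf (r.append q) (by
      rw [Walk.length_append, Bool.xor_comm]
      grind)
    exact ⟨w, c, hc, by rw [Walk.length_append] at hcle; omega⟩
  · exact h

end SimpleGraph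

/-- Let `G` have odd-girth at least `2k+1` (`k ≥ 2`), `e = {x,y}` an edge of `G`, and let
`G'` add to `G` all edges `{u,v}` such that `G` contains a path `u,x,y,v` or `u,y,x,v`.
Then `G'` contains no odd cycle of length `2ℓ-1` for any `ℓ ≤ k-1`; i.e.
odd-girth`(G') ≥ 2k-1`. -/
theorem no_short_odd_cycle_in_colon_graph {V : Type*} [Fintype V] (G : SimpleGraph V)
    (k : ℕ) (hk : 2 ≤ k)
    (hgirth : ∀ (u : V) (c : G.Walk u u), c.IsCycle → Odd c.length → 2 * k + 1 ≤ c.length)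
    (x y : V) (hxy : G.Adj x y)
    (G' : SimpleGraph V)
    (hG' : G' = G ⊔ SimpleGraph.fromRel (fun u v => G.Adj u x ∧ G.Adj y v)) :
    ∀ ℓ : ℕ, 1 ≤ ℓ → ℓ ≤ k - 1 →
      ∀ (u : V) (c : G'.Walk u u), c.IsCycle → c.length = 2 * ℓ - 1 → ¬ Odd c.length := by
  rintro ℓ hℓ hℓk u c - hlen hodd
  obtain ⟨w, d, hd, hdle⟩ := SimpleGraph.Walk.exists_odd_closed_of_adj_imp
    (f := fun b => cond b y x) hxy (fun a b hab => by
      rw [hG', SimpleGraph.sup_adj, SimpleGraph.fromRel_adj] at hab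
      obtain h | ⟨-, ⟨h₁, h₂⟩ | ⟨h₁, h₂⟩⟩ := hab
      · exact .inl h
      · exact .inr ⟨false, h₁, h₂⟩
      · exact .inr ⟨true, h₂.symm, h₁.symm⟩) c hodd
  obtain ⟨z, e, he, heodd, hele⟩ := d.exists_odd_isCycle_length_le hd
  have := hgirth z e he heodd
  omega
end
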